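/- Let A be a (possibly non-unital) associative k-algebra and r = Σᵢ uᵢ ⊗ vᵢ ∈ A ⊗ A a solution of the associative Yang–Baxter equation; equip A with the principal comultiplication Δ(a) = Σᵢ uᵢ ⊗ vᵢ·a − Σᵢ a·uᵢ ⊗ vᵢ (so A is an ε-bialgebra). Equip End(A) with the dendriform operations T ≻ S := (id ∗ T ∗ id)∘S + (id ∗ T)∘(S ∗ id), T ≺ S := T∘(id ∗ S ∗ id) + (T ∗ id)∘(id ∗ S), where T ∗ S := μ(T ⊗ S)Δ, and equip A with the dendriform operations x ≻ y := Σᵢ uᵢ·x·vᵢ·y, x ≺ y := Σᵢ x·uᵢ·y·vᵢ. Then the k-linear map π : End(A) → A, π(T) = Σᵢ T(uᵢ)·vᵢ, is a morphism of dendriform algebras: π(T ≻ S) = π(T) ≻ π(S) and π(T ≺ S) = π(T) ≺ π(S) for all T, S ∈ End(A). -/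

import Mathlib

open TensorProduct

/-- The convolution `T ∗ S = μ(T ⊗ S)Δ` of two linear endomorphisms of an
ε-bialgebra `A`. -/
noncomputable def conv (k : Type*) {A : Type*} [CommRing k] [NonUnitalRing A]
    [Module k A] [SMulCommClass k A A] [IsScalarTower k A A]
    (Δ : A →ₗ[k] A ⊗[k] A) (T S : A →ₗ[k] A) : A →ₗ[k] A :=
  (TensorProduct.lift (LinearMap.mul k A)).comp ((TensorProduct.map T S).comp Δ)

section

variable {k A ι : Type*} [CommRing k] [NonUnitalRing A] [Module k A] [SMulCommClass k A A]
  [IsScalarTower k A A] [Fintype ι] {u v : ι → A} {Δ : A →ₗ[k] A ⊗[k] A}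

/-- The convolution for the principal comultiplication, written out. -/
lemma conv_apply_of_principal
    (hΔ : ∀ a : A, Δ a = (∑ i, (u i) ⊗ₜ[k] (v i * a)) - ∑ i, (a * u i) ⊗ₜ[k] (v i))
    (T S : A →ₗ[k] A) (a : A) :
    conv k Δ T S a = ∑ i, T (u i) * S (v i * a) - ∑ i, T (a * u i) * S (v i) := by
  simp [conv, hΔ]

/-- The identity `(Δ ⊗ id)(r) = r₂₃r₁₃`, evaluated under `T`, `S` and a bilinear map. -/
lemma sum_conv_apply
    (hAYBE : (∑ i, ∑ j, (u i * u j) ⊗ₜ[k] ((v j) ⊗ₜ[k] (v i)))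
        - (∑ i, ∑ j, (u i) ⊗ₜ[k] ((v i * u j) ⊗ₜ[k] (v j)))
        + (∑ i, ∑ j, (u j) ⊗ₜ[k] ((u i) ⊗ₜ[k] (v i * v j)))
        = (0 : A ⊗[k] (A ⊗[k] A)))
    (hΔ : ∀ a : A, Δ a = (∑ i, (u i) ⊗ₜ[k] (v i * a)) - ∑ i, (a * u i) ⊗ₜ[k] (v i))
    (T S : A →ₗ[k] A) (B : A →ₗ[k] A →ₗ[k] A) :
    ∑ l, B (conv k Δ T S (u l)) (v l) = ∑ i, ∑ j, B (T (u j) * S (u i)) (v i * v j) := by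
  have h := congrArg (fun x => TensorProduct.lift B
    ((TensorProduct.map ((TensorProduct.lift (LinearMap.mul k A)).comp
      (TensorProduct.map T S)) LinearMap.id) ((TensorProduct.assoc k A A A).symm x))) hAYBE
  simp only [map_add, map_sub, map_sum, map_zero, TensorProduct.assoc_symm_tmul,
    TensorProduct.map_tmul, TensorProduct.lift.tmul, LinearMap.comp_apply, LinearMap.mul_apply',
    LinearMap.id_apply] at h
  simp only [conv_apply_of_principal hΔ, map_sub, map_sum, LinearMap.sub_apply,
    LinearMap.sum_apply, Finset.sum_sub_distrib]
  rw [Finset.sum_comm (f := fun l i => B (T (u i) * S (v i * u l)) (v l)),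
    ← sub_eq_zero, ← neg_eq_zero, ← h]
  abel

end

/-- For a quasitriangular ε-bialgebra `(A, r)` with principal comultiplication
`Δ(a) = r·a − a·r`, the map `π : End(A) → A`, `π(T) = Σᵢ T(uᵢ)·vᵢ`, is a morphism
of dendriform algebras from `End(A)` (with its convolution-composition dendriform
structure) to `A` (with the dendriform structure coming from `r`). -/
theorem end_to_A_dendriform_morphism {k A ι : Type*} [CommRing k] [NonUnitalRing A]
    [Module k A] [SMulCommClass k A A] [IsScalarTower k A A]
    [Fintype ι] (u v : ι → A)
    (hAYBE : (∑ i, ∑ j, (u i * u j) ⊗ₜ[k] ((v j) ⊗ₜ[k] (v i)))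
        - (∑ i, ∑ j, (u i) ⊗ₜ[k] ((v i * u j) ⊗ₜ[k] (v j)))
        + (∑ i, ∑ j, (u j) ⊗ₜ[k] ((u i) ⊗ₜ[k] (v i * v j)))
        = (0 : A ⊗[k] (A ⊗[k] A)))
    (Δ : A →ₗ[k] A ⊗[k] A)
    (hΔ : ∀ a : A,
      Δ a = (∑ i, (u i) ⊗ₜ[k] (v i * a)) - ∑ i, (a * u i) ⊗ₜ[k] (v i))
    (succE precE : (A →ₗ[k] A) → (A →ₗ[k] A) → (A →ₗ[k] A))
    (hsuccE : ∀ T S : A →ₗ[k] A,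
      succE T S = (conv k Δ (conv k Δ LinearMap.id T) LinearMap.id).comp S
        + (conv k Δ LinearMap.id T).comp (conv k Δ S LinearMap.id))
    (hprecE : ∀ T S : A →ₗ[k] A,
      precE T S = T.comp (conv k Δ (conv k Δ LinearMap.id S) LinearMap.id)
        + (conv k Δ T LinearMap.id).comp (conv k Δ LinearMap.id S))
    (succA precA : A → A → A)
    (hsuccA : ∀ x y : A, succA x y = ∑ i, u i * x * v i * y)
    (hprecA : ∀ x y : A, precA x y = ∑ i, x * u i * y * v i)
    (π : (A →ₗ[k] A) → A)
    (hπ : ∀ T : A →ₗ[k] A, π T = ∑ i, T (u i) * v i) :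
    ∀ T S : A →ₗ[k] A,
      π (succE T S) = succA (π T) (π S) ∧ π (precE T S) = precA (π T) (π S) := by
  intro T S
  have key := sum_conv_apply hAYBE hΔ
  have key_mul (P Q F : A →ₗ[k] A) : ∑ l, F (conv k Δ P Q (u l)) * v l
      = ∑ i, ∑ j, F (P (u j) * Q (u i)) * (v i * v j) :=
    key P Q ((LinearMap.mul k A).comp F)
  constructor
  · have h₁ (b : A) : conv k Δ (conv k Δ LinearMap.id T) LinearMap.id b
        = (∑ i, ∑ j, u j * T (u i) * (v i * v j)) * b
          - ∑ i, conv k Δ LinearMap.id T (b * u i) * v i := by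
      rw [conv_apply_of_principal hΔ (conv k Δ LinearMap.id T)]
      have h := key_mul LinearMap.id T LinearMap.id
      simp only [LinearMap.id_apply] at h ⊢
      rw [← h, Finset.sum_mul]
      simp only [mul_assoc]
    have h₂ := key_mul S LinearMap.id (conv k Δ LinearMap.id T)
    simp only [hπ, hsuccE, hsuccA, LinearMap.add_apply, LinearMap.comp_apply, add_mul,
      Finset.sum_add_distrib, h₂, h₁, sub_mul, Finset.sum_sub_distrib, LinearMap.id_apply]
    rw [Finset.sum_comm (f := fun i j => conv k Δ LinearMap.id T (S (u j) * u i) * (v i * v j))]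
    simp only [Finset.sum_mul, Finset.mul_sum, mul_assoc, sub_add_cancel]
    exact (Finset.sum_congr rfl fun _ _ => Finset.sum_comm).trans Finset.sum_comm
  · have h₁ := key_mul (conv k Δ LinearMap.id S) LinearMap.id T
    have h₂ (i : ι) := key LinearMap.id S (((LinearMap.mul k A).comp
      (T.comp (LinearMap.mulRight k (u i)))).compl₂ (LinearMap.mulLeft k (v i)))
    have h₃ := key_mul LinearMap.id S (conv k Δ T LinearMap.id)
    simp only [LinearMap.compl₂_apply, LinearMap.comp_apply, LinearMap.mul_apply',
      LinearMap.mulRight_apply, LinearMap.mulLeft_apply, LinearMap.id_apply] at h₁ h₂ h₃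
    simp only [hπ, hprecE, hprecA, LinearMap.add_apply, LinearMap.comp_apply, add_mul,
      Finset.sum_add_distrib, h₁, h₂, h₃]
    simp only [conv_apply_of_principal hΔ T, LinearMap.id_apply, sub_mul,
      Finset.sum_sub_distrib, Finset.sum_mul, Finset.mul_sum, mul_assoc]
    rw [add_sub_left_comm]
    refine (congrArg₂ (· + ·) Finset.sum_comm (sub_eq_zero.2 ?_)).trans (add_zero _)
    exact ((Finset.sum_congr rfl fun _ _ => Finset.sum_comm).trans Finset.sum_comm).symm
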